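/- Let M be a definite multi-context system with grounded equilibrium S = (S_1,…,S_n). For every belief set S_i of S and every justification M_just of S_i, there exists a support M_supp ⊆ M of the context C_i such that M_just ⊆ M_supp and all bridge rules of M_just are satisfied in S. -/

import Mathlib

/-- A bridge rule of a definite MCS: a head literal and a finite positive body. -/
structure Rule (n : ℕ) (α : Type*) where
  head : α
  body : Finset (Fin n × α)
deriving DecidableEq

/-- A definite multi-context system: for each context, a monotone semantic
operator and a finite set of bridge rules. -/
structure MCS (n : ℕ) (α : Type*) [DecidableEq α] where
  ACC : Fin n → Finset α → Finset α
  mono : ∀ i, Monotone (ACC i)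
  br : Fin n → Finset (Rule n α)

variable {n : ℕ} {α : Type*} [DecidableEq α]

/-- A bridge rule is satisfied in a belief state `S` iff every body literal holds. -/
def Satisfied (r : Rule n α) (S : Fin n → Finset α) : Prop :=
  ∀ cp ∈ r.body, cp.2 ∈ S cp.1

instance (r : Rule n α) (S : Fin n → Finset α) : Decidable (Satisfied r S) := by
  unfold Satisfied; infer_instance

/-- The knowledge base induced at context `i` by belief state `S`:
the heads of the bridge rules of context `i` satisfied in `S`. -/
def kbOf (M : MCS n α) (S : Fin n → Finset α) (i : Fin n) : Finset α :=
  ((M.br i).filter (fun r => Satisfied r S)).image Rule.head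

/-- A belief state is an equilibrium iff each belief set is the result of
applying the semantic operator to the induced knowledge base. -/
def IsEquilibrium (M : MCS n α) (S : Fin n → Finset α) : Prop :=
  ∀ i, S i = M.ACC i (kbOf M S i)

/-- The grounded equilibrium: the pointwise-⊆-least equilibrium. -/
def IsGrounded (M : MCS n α) (S : Fin n → Finset α) : Prop :=
  IsEquilibrium M S ∧ ∀ E, IsEquilibrium M E → ∀ i, S i ⊆ E i

/-- `M'` is a fragment of `M`: same contexts and operators, fewer bridge rules. -/
def Fragment (M' M : MCS n α) : Prop :=
  M'.ACC = M.ACC ∧ ∀ i, M'.br i ⊆ M.br i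

/-- The defining conditions of a justification of the belief set `S i` (w.r.t. the
grounded equilibrium `S` of the ambient MCS): the fragment has a grounded equilibrium
`S'` with `S' i = S i` and `S' j ⊆ S j` for all `j ≠ i`. -/
def JustCond (M' : MCS n α) (S : Fin n → Finset α) (i : Fin n) : Prop :=
  ∃ S' : Fin n → Finset α, IsGrounded M' S' ∧ S' i = S i ∧ ∀ j, j ≠ i → S' j ⊆ S j

/-- `M'` is a justification of the belief set `S i` of the grounded equilibrium `S`
of `M`: a fragment of `M` satisfying the justification conditions such that no
strictly smaller fragment (componentwise on bridge-rule sets) satisfies them. -/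
def IsJustification (M' M : MCS n α) (S : Fin n → Finset α) (i : Fin n) : Prop :=
  Fragment M' M ∧ JustCond M' S i ∧
  ∀ M'' : MCS n α, Fragment M'' M' → M''.br ≠ M'.br → ¬ JustCond M'' S i

/-- The input signature of context `i`: the heads of its bridge rules. -/
def sig (M : MCS n α) (i : Fin n) : Finset α :=
  (M.br i).image Rule.head

/-- `In` is an immediate rule support of context `i`: a subset of `br i` containing,
for every literal of the input signature of `i`, a rule with that head. -/
def ImmRuleSupport (M : MCS n α) (i : Fin n) (In : Finset (Rule n α)) : Prop :=
  In ⊆ M.br i ∧ ∀ p ∈ sig M i, ∃ r ∈ In, r.head = p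

/-- The (recursive) defining conditions of a support of context `i`, read
coinductively: there is a family `F` of (bridge-rule tuple, context) pairs
containing `(br', i)` such that every member `(b, j)` of `F` is a fragment of `M`
containing an immediate rule support of `j`, and for every body literal `(c, p)` of
every rule of `b`, `b` contains a member of `F` supporting `c`. -/
def SupportPre (M : MCS n α) (br' : Fin n → Finset (Rule n α)) (i : Fin n) : Prop :=
  ∃ F : Set ((Fin n → Finset (Rule n α)) × Fin n),
    (br', i) ∈ F ∧
    ∀ q ∈ F,
      (∀ j, q.1 j ⊆ M.br j) ∧
      (∃ In, ImmRuleSupport M q.2 In ∧ In ⊆ q.1 q.2) ∧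
      ∀ j, ∀ r ∈ q.1 j, ∀ cp ∈ r.body,
        ∃ b : Fin n → Finset (Rule n α), (∀ k, b k ⊆ q.1 k) ∧ (b, cp.1) ∈ F

/-- `br'` is a support of context `i` in `M`: it satisfies the support conditions
and its bridge-rule sets are ⊆-minimal (componentwise) subject to them. -/
def IsSupport (M : MCS n α) (br' : Fin n → Finset (Rule n α)) (i : Fin n) : Prop :=
  SupportPre M br' i ∧
  ∀ b : Fin n → Finset (Rule n α),
    (∀ j, b j ⊆ br' j) → b ≠ br' → ¬ SupportPre M b i

/-- The MCS with the contexts and operators of `M` and the bridge rules `g`. -/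
def MCS.withRules (M : MCS n α) (g : Fin n → Finset (Rule n α)) : MCS n α :=
  ⟨M.ACC, M.mono, g⟩

/-- `E` is closed under one simultaneous application of all contexts. -/
def IsPreEquilibrium (M : MCS n α) (E : Fin n → Finset α) : Prop :=
  ∀ i, M.ACC i (kbOf M E i) ⊆ E i

theorem Satisfied.mono {β : Type*} {r : Rule n β} {S T : Fin n → Finset β} (h : ∀ i, S i ⊆ T i)
    (hr : Satisfied r S) : Satisfied r T :=
  fun cp hcp => h _ (hr cp hcp)

theorem mem_kbOf {M : MCS n α} {S : Fin n → Finset α} {i : Fin n} {p : α} :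
    p ∈ kbOf M S i ↔ ∃ r ∈ M.br i, Satisfied r S ∧ r.head = p := by
  simp [kbOf, and_assoc]

theorem kbOf_subset_kbOf {M' M : MCS n α} (hM : ∀ i, M'.br i ⊆ M.br i)
    {S T : Fin n → Finset α} (h : ∀ i, S i ⊆ T i) (i : Fin n) :
    kbOf M' S i ⊆ kbOf M T i := by
  intro p hp
  obtain ⟨r, hr, hs, rfl⟩ := mem_kbOf.1 hp
  exact mem_kbOf.2 ⟨r, hM i hr, hs.mono h, rfl⟩

theorem IsEquilibrium.isPreEquilibrium {M : MCS n α} {E : Fin n → Finset α}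
    (h : IsEquilibrium M E) : IsPreEquilibrium M E :=
  fun i => (h i).symm.subset

theorem exists_least_preEquilibrium (M : MCS n α) :
    ∃ L, IsEquilibrium M L ∧ ∀ E, IsPreEquilibrium M E → ∀ i, L i ⊆ E i := by
  classical
  let B : Fin n → Finset α := fun i => M.ACC i (sig M i)
  have hB : ∀ E i, M.ACC i (kbOf M E i) ⊆ B i := fun E i =>
    M.mono i (Finset.image_subset_image (Finset.filter_subset _ _))
  let L : Fin n → Finset α := fun i =>
    (B i).filter fun x => ∀ E, IsPreEquilibrium M E → x ∈ E i
  have hL : ∀ E, IsPreEquilibrium M E → ∀ i, L i ⊆ E i := fun E hE i x hx =>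
    (Finset.mem_filter.1 hx).2 E hE
  have hpre : IsPreEquilibrium M L := fun i x hx =>
    Finset.mem_filter.2 ⟨hB L i hx, fun E hE =>
      hE i (M.mono i (kbOf_subset_kbOf (fun _ => subset_rfl) (hL E hE) i) hx)⟩
  refine ⟨L, fun i => subset_antisymm ?_ (hpre i), hL⟩
  exact hL (fun j => M.ACC j (kbOf M L j))
    (fun j => M.mono j (kbOf_subset_kbOf (fun _ => subset_rfl) hpre j)) i

theorem IsGrounded.subset_of_isPreEquilibrium {M : MCS n α} {S E : Fin n → Finset α}
    (hS : IsGrounded M S) (hE : IsPreEquilibrium M E) (i : Fin n) : S i ⊆ E i := by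
  obtain ⟨L, hL, hle⟩ := exists_least_preEquilibrium M
  exact (hS.2 L hL i).trans (hle E hE i)

theorem exists_isGrounded (M : MCS n α) : ∃ S, IsGrounded M S := by
  obtain ⟨L, hL, hle⟩ := exists_least_preEquilibrium M
  exact ⟨L, hL, fun E hE => hle E hE.isPreEquilibrium⟩

theorem IsGrounded.subset_of_fragment {M' M : MCS n α} (h : Fragment M' M)
    {S' S : Fin n → Finset α} (hS' : IsGrounded M' S') (hS : IsGrounded M S) (i : Fin n) :
    S' i ⊆ S i := by
  refine hS'.subset_of_isPreEquilibrium (fun j => ?_) i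
  rw [h.1]
  exact (M.mono j (kbOf_subset_kbOf h.2 (fun _ => subset_rfl) j)).trans
    (hS.1.isPreEquilibrium j)

/-- The grounded equilibrium of a fragment is that of the whole system as soon as the
additional rules contribute no new heads. -/
theorem IsGrounded.subset_of_kbOf_subset {M' M : MCS n α} (h : M'.ACC = M.ACC)
    {E T : Fin n → Finset α} (hE : IsGrounded M' E) (hT : IsGrounded M T)
    (hkb : ∀ j, kbOf M E j ⊆ kbOf M' E j) (i : Fin n) : T i ⊆ E i := by
  refine hT.subset_of_isPreEquilibrium (fun j => ?_) i
  refine (M.mono j (hkb j)).trans ?_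
  rw [← h]
  exact hE.1.isPreEquilibrium j

section Justification

variable {M J : MCS n α} {S T : Fin n → Finset α} {i : Fin n}

theorem IsJustification.br_eq_of_subset (hJ : IsJustification J M S i) (hS : IsGrounded M S)
    (hT : IsGrounded J T) {g : Fin n → Finset (Rule n α)} (hg : ∀ j, g j ⊆ J.br j)
    {E : Fin n → Finset α} (hE : IsGrounded (J.withRules g) E) (hi : T i ⊆ E i) :
    g = J.br := by
  by_contra hne
  obtain ⟨T', hT', hTi, -⟩ := hJ.2.1
  have hfrag : Fragment (J.withRules g) J := ⟨rfl, hg⟩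
  have hET := hE.subset_of_fragment hfrag hT
  have hTS := hT.subset_of_fragment hJ.1 hS
  refine hJ.2.2 _ hfrag hne ⟨E, hE, ?_, fun j _ => (hET j).trans (hTS j)⟩
  refine subset_antisymm ((hET i).trans (hTS i)) ?_
  rw [← hTi]
  exact (hT'.2 T hT.1 i).trans hi

theorem IsJustification.satisfied (hJ : IsJustification J M S i) (hS : IsGrounded M S)
    {j : Fin n} {r : Rule n α} (hr : r ∈ J.br j) : Satisfied r S := by
  obtain ⟨T, hT⟩ := exists_isGrounded J
  let g : Fin n → Finset (Rule n α) := fun j => (J.br j).filter fun r => Satisfied r T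
  have hg : ∀ j, g j ⊆ J.br j := fun j => Finset.filter_subset _ _
  obtain ⟨E, hE⟩ := exists_isGrounded (J.withRules g)
  have hET := hE.subset_of_fragment (show Fragment (J.withRules g) J from ⟨rfl, hg⟩) hT
  have hTE : T i ⊆ E i := by
    refine hE.subset_of_kbOf_subset (M := J) (by rfl) hT (fun k p hp => ?_) i
    obtain ⟨r, hr, hs, rfl⟩ := mem_kbOf.1 hp
    exact mem_kbOf.2 ⟨r, Finset.mem_filter.2 ⟨hr, hs.mono hET⟩, hs, rfl⟩
  rw [← hJ.br_eq_of_subset hS hT hg hE hTE] at hr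
  exact (Finset.mem_filter.1 hr).2.mono (hT.subset_of_fragment hJ.1 hS)

/-- If a rule is dropped from a justification, then in the resulting grounded equilibrium
the rule is satisfied, but no other rule of the same context with the same head is. -/
theorem IsJustification.satisfied_of_erase (hJ : IsJustification J M S i)
    (hS : IsGrounded M S) {j : Fin n} {r s : Rule n α} (hr : r ∈ J.br j) (hs : s ∈ J.br j)
    (hrs : s ≠ r) (hd : s.head = r.head) {E : Fin n → Finset α}
    (hE : IsGrounded
      (J.withRules (Function.update J.br j ((J.br j).erase r))) E) :
    Satisfied r E ∧ ¬ Satisfied s E := by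
  by_contra hcon
  obtain ⟨T, hT⟩ := exists_isGrounded J
  let g := Function.update J.br j ((J.br j).erase r)
  have hg : ∀ k, g k ⊆ J.br k := by
    intro k
    by_cases hk : k = j
    · subst hk; simpa [g] using Finset.erase_subset _ _
    · simp [g, hk]
  have hTE : T i ⊆ E i := by
    refine hE.subset_of_kbOf_subset (M := J) (by rfl) hT (fun k p hp => ?_) i
    obtain ⟨q, hq, hqs, rfl⟩ := mem_kbOf.1 hp
    by_cases hk : k = j
    · subst hk
      by_cases hqr : q = r
      · subst hqr
        have hsE : Satisfied s E := by tauto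
        exact mem_kbOf.2 ⟨s, by simp [MCS.withRules, hrs, hs], hsE, hd⟩
      · exact mem_kbOf.2 ⟨q, by simp [MCS.withRules, hqr, hq], hqs, rfl⟩
    · exact mem_kbOf.2 ⟨q, by simpa [MCS.withRules, hk] using hq, hqs, rfl⟩
  have := hJ.br_eq_of_subset hS hT hg hE hTE
  rw [← this] at hr
  simp [g] at hr

theorem IsJustification.eq_of_head_eq (hJ : IsJustification J M S i) (hS : IsGrounded M S)
    {j : Fin n} {r s : Rule n α} (hr : r ∈ J.br j) (hs : s ∈ J.br j)
    (hd : r.head = s.head) : r = s := by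
  by_contra hne
  have key : ∀ {r s : Rule n α}, r ∈ J.br j → s ∈ J.br j → s ≠ r → s.head = r.head →
      ∀ {E E₀ : Fin n → Finset α},
      IsGrounded (J.withRules (Function.update J.br j ((J.br j).erase r))) E →
      IsGrounded (J.withRules (Function.update J.br j (((J.br j).erase r).erase s))) E₀ →
      Satisfied r E₀ ∧ ¬ Satisfied s E₀ := by
    intro r s hr hs hrs hd E E₀ hE hE₀
    have hfrag : Fragment
        (J.withRules (Function.update J.br j (((J.br j).erase r).erase s)))
        (J.withRules (Function.update J.br j ((J.br j).erase r))) := by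
      refine ⟨rfl, fun k => ?_⟩
      by_cases hk : k = j
      · subst hk; simpa [MCS.withRules] using Finset.erase_subset _ _
      · simp [MCS.withRules, hk]
    have hle := hE₀.subset_of_fragment hfrag hE
    have hsat := hJ.satisfied_of_erase hS hr hs hrs hd hE
    have hge : ∀ k, E k ⊆ E₀ k := by
      refine hE₀.subset_of_kbOf_subset (M := J.withRules
        (Function.update J.br j ((J.br j).erase r))) (by rfl) hE (fun k p hp => ?_)
      obtain ⟨q, hq, hqs, rfl⟩ := mem_kbOf.1 hp
      refine mem_kbOf.2 ⟨q, ?_, hqs, rfl⟩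
      by_cases hk : k = j
      · subst hk
        have hqne : q ≠ s := by
          rintro rfl
          exact hsat.2 (hqs.mono hle)
        simpa [MCS.withRules, hqne] using hq
      · simpa [MCS.withRules, hk] using hq
    exact ⟨hsat.1.mono hge, fun h => hsat.2 (h.mono hle)⟩
  obtain ⟨E₁, h₁⟩ := exists_isGrounded
    (J.withRules (Function.update J.br j ((J.br j).erase r)))
  obtain ⟨E₂, h₂⟩ := exists_isGrounded
    (J.withRules (Function.update J.br j ((J.br j).erase s)))
  obtain ⟨E₀, h₀⟩ := exists_isGrounded
    (J.withRules (Function.update J.br j (((J.br j).erase r).erase s)))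
  have h₀' := h₀
  rw [Finset.erase_right_comm] at h₀'
  exact (key hr hs (Ne.symm hne) hd.symm h₁ h₀).2 (key hs hr hne hd h₂ h₀').1

/-- Context `d` occurs in the body of some rule of context `c`. -/
def BodyRefersTo (g : Fin n → Finset (Rule n α)) (c d : Fin n) : Prop :=
  ∃ r ∈ g c, ∃ p, (d, p) ∈ r.body

theorem IsJustification.reachable (hJ : IsJustification J M S i) (hS : IsGrounded M S)
    {j : Fin n} {r : Rule n α} (hr : r ∈ J.br j) :
    Relation.ReflTransGen (BodyRefersTo J.br) i j := by
  classical
  obtain ⟨T, hT⟩ := exists_isGrounded J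
  let R : Fin n → Prop := Relation.ReflTransGen (BodyRefersTo J.br) i
  let g : Fin n → Finset (Rule n α) := fun k => if R k then J.br k else ∅
  have hg : ∀ k, g k ⊆ J.br k := by
    intro k
    by_cases hk : R k <;> simp [g, hk]
  obtain ⟨E, hE⟩ := exists_isGrounded (J.withRules g)
  have hET := hE.subset_of_fragment (show Fragment (J.withRules g) J from ⟨rfl, hg⟩) hT
  let E' : Fin n → Finset α := fun k => if R k then E k else T k
  have hE'T : ∀ k, E' k ⊆ T k := by
    intro k
    by_cases hk : R k
    · simpa [E', hk] using hET k
    · simp [E', hk]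
  have hpre : IsPreEquilibrium J E' := by
    intro k
    by_cases hk : R k
    · have hkb : kbOf J E' k ⊆ kbOf (J.withRules g) E k := by
        intro p hp
        obtain ⟨q, hq, hqs, rfl⟩ := mem_kbOf.1 hp
        refine mem_kbOf.2 ⟨q, by simpa [MCS.withRules, g, hk] using hq, fun cp hcp => ?_, rfl⟩
        have hcR : R cp.1 := Relation.ReflTransGen.tail hk ⟨q, hq, cp.2, hcp⟩
        simpa [E', hcR] using hqs cp hcp
      have hEk : E' k = E k := by simp [E', hk]
      rw [hEk]
      exact (J.mono k hkb).trans (hE.1.isPreEquilibrium k)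
    · have hEk : E' k = T k := by simp [E', hk]
      rw [hEk]
      exact (J.mono k (kbOf_subset_kbOf (fun _ => subset_rfl) hE'T k)).trans
        (hT.1.isPreEquilibrium k)
  have hTE : T i ⊆ E i := by
    have hiR : R i := Relation.ReflTransGen.refl
    simpa [E', hiR] using hT.subset_of_isPreEquilibrium hpre i
  rw [← hJ.br_eq_of_subset hS hT hg hE hTE] at hr
  by_contra hj
  have hj' : ¬ R j := hj
  simp [g, hj'] at hr

end Justification

/-- A supporting rule tuple covers the signature of its own context and of every context
mentioned in one of its rule bodies. -/
theorem SupportPre.covers {M : MCS n α} {b : Fin n → Finset (Rule n α)} {i : Fin n}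
    (h : SupportPre M b i) :
    (∀ p ∈ sig M i, ∃ r ∈ b i, r.head = p) ∧
      ∀ c d, BodyRefersTo b c d → ∀ p ∈ sig M d, ∃ r ∈ b d, r.head = p := by
  obtain ⟨F, hi, hF⟩ := h
  have cov : ∀ q ∈ F, ∀ p ∈ sig M q.2, ∃ r ∈ q.1 q.2, r.head = p := by
    intro q hq p hp
    obtain ⟨-, ⟨In, hIn, hsub⟩, -⟩ := hF q hq
    obtain ⟨r, hr, hd⟩ := hIn.2 p hp
    exact ⟨r, hsub hr, hd⟩
  refine ⟨cov _ hi, ?_⟩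
  rintro c d ⟨r, hr, x, hx⟩ p hp
  obtain ⟨b', hb', hmem⟩ := (hF _ hi).2.2 c r hr _ hx
  obtain ⟨s, hs, hd⟩ := cov _ hmem p hp
  exact ⟨s, hb' _ hs, hd⟩

theorem supportPre_of_covers {M : MCS n α} {b : Fin n → Finset (Rule n α)} {i : Fin n}
    (hb : ∀ j, b j ⊆ M.br j) (hi : ∀ p ∈ sig M i, ∃ r ∈ b i, r.head = p)
    (hdep : ∀ c d, BodyRefersTo b c d → ∀ p ∈ sig M d, ∃ r ∈ b d, r.head = p) :
    SupportPre M b i := by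
  refine ⟨{q | q.1 = b ∧ ∀ p ∈ sig M q.2, ∃ r ∈ b q.2, r.head = p}, ⟨rfl, hi⟩, ?_⟩
  rintro ⟨_, j⟩ ⟨rfl, hj⟩
  exact ⟨hb, ⟨_, ⟨hb j, hj⟩, subset_rfl⟩, fun c r hr cp hcp =>
    ⟨_, fun _ => subset_rfl, rfl, hdep c cp.1 ⟨r, hr, cp.2, hcp⟩⟩⟩

/-- Choosing one rule for every context and signature literal, and keeping the choices of
the contexts reachable from `i`, yields a support of `i`. -/
theorem exists_isSupport_of_choice (M : MCS n α) (i : Fin n) (f : Fin n → α → Rule n α)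
    (hf : ∀ c, ∀ p ∈ sig M c, f c p ∈ M.br c ∧ (f c p).head = p) :
    ∃ b : Fin n → Finset (Rule n α), (∀ j, b j ⊆ M.br j) ∧ IsSupport M b i ∧
      ∀ j, Relation.ReflTransGen (BodyRefersTo fun c => (sig M c).image (f c)) i j →
        (sig M j).image (f j) ⊆ b j := by
  classical
  let G : Fin n → Finset (Rule n α) := fun c => (sig M c).image (f c)
  let R : Fin n → Prop := Relation.ReflTransGen (BodyRefersTo G) i
  let b : Fin n → Finset (Rule n α) := fun c => if R c then G c else ∅
  have hbR : ∀ {c r}, r ∈ b c ↔ R c ∧ r ∈ G c := by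
    intro c r
    by_cases hc : R c <;> simp [b, hc]
  have hb : ∀ j, b j ⊆ M.br j := by
    intro j r hr
    obtain ⟨p, hp, rfl⟩ := Finset.mem_image.1 (hbR.1 hr).2
    exact (hf j p hp).1
  have hcov : ∀ j, R j → ∀ p ∈ sig M j, ∃ r ∈ b j, r.head = p := fun j hj p hp =>
    ⟨f j p, hbR.2 ⟨hj, Finset.mem_image_of_mem _ hp⟩, (hf j p hp).2⟩
  refine ⟨b, hb, ⟨supportPre_of_covers hb (hcov i .refl) ?_, ?_⟩,
    fun j hj r hr => hbR.2 ⟨hj, hr⟩⟩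
  · rintro c d ⟨r, hr, x, hx⟩
    exact hcov d (Relation.ReflTransGen.tail (hbR.1 hr).1 ⟨r, (hbR.1 hr).2, x, hx⟩)
  · intro b' hb' hne hsup
    obtain ⟨hi, hdep⟩ := hsup.covers
    have full : ∀ j, (∀ p ∈ sig M j, ∃ r ∈ b' j, r.head = p) → G j ⊆ b' j := by
      intro j hj r hr
      obtain ⟨p, hp, rfl⟩ := Finset.mem_image.1 hr
      obtain ⟨s, hs, hsp⟩ := hj p hp
      obtain ⟨p', hp', rfl⟩ := Finset.mem_image.1 (hbR.1 (hb' j hs)).2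
      rw [(hf j p' hp').2] at hsp
      rwa [← hsp]
    have hall : ∀ j, R j → G j ⊆ b' j := by
      intro j hj
      induction hj with
      | refl => exact full i hi
      | tail _ hcd ih =>
        obtain ⟨r, hr, x, hx⟩ := hcd
        exact full _ (hdep _ _ ⟨r, ih hr, x, hx⟩)
    exact hne (funext fun j => subset_antisymm (hb' j) fun r hr =>
      hall j (hbR.1 hr).1 (hbR.1 hr).2)

/-- for every belief set `S i` of the grounded equilibrium `S` of `M`
and every justification `M_just` of `S i`, there is a support `M_supp ⊆ M` of the
context `i` with `M_just ⊆ M_supp`, and all bridge rules of `M_just` are satisfied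
in `S`. -/
theorem justification_contained_in_support (M M_just : MCS n α)
    (S : Fin n → Finset α) (hS : IsGrounded M S) (i : Fin n)
    (hJ : IsJustification M_just M S i) :
    ∃ M_supp : MCS n α, Fragment M_supp M ∧ IsSupport M M_supp.br i ∧
      (∀ j, M_just.br j ⊆ M_supp.br j) ∧
      ∀ j, ∀ r ∈ M_just.br j, Satisfied r S := by
  have hchoice : ∀ c p, ∃ r : Rule n α, p ∈ sig M c →
      (r ∈ M.br c ∧ r.head = p) ∧ ∀ s ∈ M_just.br c, s.head = p → s = r := by
    intro c p
    by_cases hex : ∃ s ∈ M_just.br c, s.head = p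
    · obtain ⟨s, hs, hd⟩ := hex
      exact ⟨s, fun _ => ⟨⟨hJ.1.2 c hs, hd⟩, fun t ht htp =>
        hJ.eq_of_head_eq hS ht hs (htp.trans hd.symm)⟩⟩
    · by_cases hp : p ∈ sig M c
      · obtain ⟨r, hr, hd⟩ := Finset.mem_image.1 hp
        exact ⟨r, fun _ => ⟨⟨hr, hd⟩, fun s hs hsp => absurd ⟨s, hs, hsp⟩ hex⟩⟩
      · exact ⟨⟨p, ∅⟩, fun h => absurd h hp⟩
  choose f hf using hchoice
  obtain ⟨b, hb, hsup, hreach⟩ :=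
    exists_isSupport_of_choice M i f fun c p hp => (hf c p hp).1
  have hsub : ∀ c, M_just.br c ⊆ (sig M c).image (f c) := by
    intro c r hr
    have hp : r.head ∈ sig M c := Finset.mem_image_of_mem _ (hJ.1.2 c hr)
    exact Finset.mem_image.2 ⟨r.head, hp, ((hf c _ hp).2 r hr rfl).symm⟩
  refine ⟨M.withRules b, ⟨rfl, hb⟩, hsup, fun j r hr => hreach j ?_ (hsub j hr),
    fun j r hr => hJ.satisfied hS hr⟩
  refine Relation.ReflTransGen.mono ?_ _ _ (hJ.reachable hS hr)
  rintro c d ⟨s, hs, x, hx⟩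
  exact ⟨s, hsub c hs, x, hx⟩
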